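/- (Monotonicity of the Proximus iteration.) Let X ∈ {0,1}^{m×n}. Define one Proximus iteration from (u,v) ∈ {0,1}^m × {0,1}^n to (u',v') by u'_i = 1((X_{i:})·v > h(v)/2) for all i, followed by v'_j = 1((X_{:j})·u' > h(u')/2) for all j. Then h(X ⊕ u'(v')^T) ≤ h(X ⊕ uv^T); consequently the sequence of costs h(X ⊕ u^{(t)}(v^{(t)})^T) generated by iterating this map is non-increasing and, being a non-increasing sequence of nonnegative integers, is eventually constant. -/

import Mathlib

open Finset

/-- Hamming weight of a binary vector. -/
def hW {m : ℕ} (x : Fin m → Bool) : ℕ :=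
  (univ.filter fun i => x i = true).card

/-- Hamming weight of a binary matrix. -/
def hM {m n : ℕ} (X : Fin m → Fin n → Bool) : ℕ :=
  (univ.filter fun p : Fin m × Fin n => X p.1 p.2 = true).card

/-- Integer inner product of two binary vectors. -/
def dotB {m : ℕ} (x y : Fin m → Bool) : ℕ :=
  (univ.filter fun i => (x i && y i) = true).card

/-- Cost h(X ⊕ u vᵀ) of the rank-one XOR approximation. -/
def cost {m n : ℕ} (X : Fin m → Fin n → Bool) (u : Fin m → Bool) (v : Fin n → Bool) : ℕ :=
  hM (fun i j => xor (X i j) (u i && v j))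

/-- One Proximus iteration: first update u from v, then update v from the new u. -/
def proximusStep {m n : ℕ} (X : Fin m → Fin n → Bool)
    (p : (Fin m → Bool) × (Fin n → Bool)) : (Fin m → Bool) × (Fin n → Bool) :=
  let u' : Fin m → Bool := fun i => decide ((dotB (X i) p.2 : ℚ) > (hW p.2 : ℚ) / 2)
  let v' : Fin n → Bool := fun j => decide ((dotB (fun i => X i j) u' : ℚ) > (hW u' : ℚ) / 2)
  (u', v')

theorem hW_xor_add_two_mul_dotB {n : ℕ} (x v : Fin n → Bool) :
    hW (fun j => xor (x j) (v j)) + 2 * dotB x v = hW x + hW v := by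
  simp only [hW, dotB, card_filter, mul_sum, ← sum_add_distrib]
  refine sum_congr rfl fun j _ => ?_
  cases x j <;> cases v j <;> simp

theorem cost_eq_sum_rows {m n : ℕ} (X : Fin m → Fin n → Bool) (u : Fin m → Bool)
    (v : Fin n → Bool) :
    cost X u v = ∑ i, hW (fun j => xor (X i j) (u i && v j)) := by
  simp only [cost, hM, hW, card_filter, Fintype.sum_prod_type]

theorem cost_transpose {m n : ℕ} (X : Fin m → Fin n → Bool) (u : Fin m → Bool)
    (v : Fin n → Bool) : cost (fun j i => X i j) v u = cost X u v := by
  simp only [cost, hM, card_filter, Fintype.sum_prod_type]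
  rw [sum_comm]
  simp only [Bool.and_comm]

/-- For fixed `v`, thresholding the rows at `h(v) / 2` minimizes the cost over all `u`. -/
theorem cost_threshold_le {m n : ℕ} (X : Fin m → Fin n → Bool) (u : Fin m → Bool)
    (v : Fin n → Bool) :
    cost X (fun i => decide ((dotB (X i) v : ℚ) > (hW v : ℚ) / 2)) v ≤ cost X u v := by
  rw [cost_eq_sum_rows, cost_eq_sum_rows]
  refine sum_le_sum fun i _ => ?_
  have key := hW_xor_add_two_mul_dotB (X i) v
  have eta : hW (fun j => X i j) = hW (X i) := rfl
  have threshold : (dotB (X i) v : ℚ) > (hW v : ℚ) / 2 ↔ hW v < 2 * dotB (X i) v := by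
    rw [gt_iff_lt, div_lt_iff₀' two_pos]
    exact_mod_cast Iff.rfl
  simp only [threshold]
  by_cases h : hW v < 2 * dotB (X i) v <;> cases u i <;>
    simp only [h, decide_true, decide_false, Bool.true_and, Bool.false_and, Bool.xor_false] <;>
    omega

theorem cost_proximusStep_le {m n : ℕ} (X : Fin m → Fin n → Bool)
    (p : (Fin m → Bool) × (Fin n → Bool)) :
    cost X (proximusStep X p).1 (proximusStep X p).2 ≤ cost X p.1 p.2 := by
  refine le_trans ?_ (cost_threshold_le X p.1 p.2)
  rw [← cost_transpose X, ← cost_transpose X]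
  exact cost_threshold_le (fun j i => X i j) p.2 (proximusStep X p).1

/-- one Proximus iteration does not increase the rank-one XOR cost;
consequently, the sequence of costs generated by iterating the map is non-increasing
and eventually constant. -/
theorem proximus_iteration_monotone {m n : ℕ} (X : Fin m → Fin n → Bool) :
    (∀ (u : Fin m → Bool) (v : Fin n → Bool),
      cost X (proximusStep X (u, v)).1 (proximusStep X (u, v)).2 ≤ cost X u v) ∧
    (∀ p₀ : (Fin m → Bool) × (Fin n → Bool),
      (Antitone fun t : ℕ =>
        cost X ((proximusStep X)^[t] p₀).1 ((proximusStep X)^[t] p₀).2) ∧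
      ∃ (N : ℕ) (c : ℕ), ∀ t ≥ N,
        cost X ((proximusStep X)^[t] p₀).1 ((proximusStep X)^[t] p₀).2 = c) := by
  refine ⟨fun u v => cost_proximusStep_le X (u, v), fun p₀ => ?_⟩
  have anti : Antitone fun t : ℕ =>
      cost X ((proximusStep X)^[t] p₀).1 ((proximusStep X)^[t] p₀).2 := by
    refine antitone_nat_of_succ_le fun t => ?_
    rw [Function.iterate_succ_apply']
    exact cost_proximusStep_le X _
  obtain ⟨N, hN⟩ := WellFoundedLT.antitone_chain_condition anti
  exact ⟨anti, N, _, fun t ht => (hN t ht).symm⟩
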